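/- Let K be a finitely generated field of characteristic different from 3, and let d ≥ 2 be an integer. Then there exist two linearly independent homogeneous polynomials F_0, F_1 of degree d in K[x_0, x_1, x_2] such that for every (a_0, a_1) ∈ K^2 \ {0}, the polynomial a_0F_0 + a_1F_1 cuts out a smooth plane curve of degree d in ℙ^2 (i.e., a K-smooth pencil of degree-d curves exists in ℙ^2). -/

import Mathlib

open MvPolynomial

/-- A homogeneous polynomial `F` of degree `d` in `K[x_0, x_1, x_2]` cuts out a smooth
plane curve in `ℙ^2` if there is no point `t ≠ 0` with coordinates in an algebraic closure
of `K` at which `F` and all its partial derivatives vanish simultaneously. -/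
def CutsOutSmoothPlaneCurve {K : Type*} [Field K]
    (F : MvPolynomial (Fin 3) K) : Prop :=
  ∀ t : Fin 3 → AlgebraicClosure K, t ≠ 0 →
    ¬ (eval t (map (algebraMap K (AlgebraicClosure K)) F) = 0 ∧
       ∀ i : Fin 3,
         eval t (map (algebraMap K (AlgebraicClosure K)) (pderiv i F)) = 0)

theorem AlgebraicIndependent.linearIndependent_adjoin {F E ι κ : Type*} [Field F] [Field E]
    [Algebra F E] {x : ι → E} (hx : AlgebraicIndependent F x) {v : κ → algebraicClosure F E}
    (hv : LinearIndependent F v) :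
    LinearIndependent (Algebra.adjoin F (Set.range x)) fun k ↦ (v k : E) := by
  rw [linearIndependent_iff'] at hv ⊢
  intro s g hg k hk
  set P : κ → MvPolynomial ι F := fun k ↦ hx.aevalEquiv.symm (g k) with hP
  have haeval : ∀ k, aeval x (P k) = (g k : E) := fun k ↦ by
    rw [← hx.algebraMap_aevalEquiv, hP, AlgEquiv.apply_symm_apply]
    rfl
  have hsum : ∑ k ∈ s, C (v k) *
      MvPolynomial.map (algebraMap F (algebraicClosure F E)) (P k) = 0 := by
    refine hx.algebraicClosure.eq_zero_of_aeval_eq_zero _ ?_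
    rw [map_sum, ← hg]
    refine Finset.sum_congr rfl fun k _ ↦ ?_
    rw [map_mul, aeval_map_algebraMap, haeval, aeval_C, Subalgebra.smul_def, smul_eq_mul, mul_comm]
    rfl
  suffices hPk : P k = 0 from
    hx.aevalEquiv.symm.injective ((show hx.aevalEquiv.symm (g k) = 0 from hPk).trans
      (map_zero _).symm)
  ext m
  refine hv s (fun k ↦ coeff m (P k)) ?_ k hk
  have := congrArg (coeff m) hsum
  simpa [coeff_sum, coeff_C_mul, coeff_map, Algebra.smul_def, mul_comm] using this

/-- The relative algebraic closure of the base field in a finitely generated extension is finite. -/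
theorem finiteDimensional_algebraicClosure_of_essFiniteType (F E : Type*) [Field F] [Field E]
    [Algebra F E] [Algebra.EssFiniteType F E] : FiniteDimensional F (algebraicClosure F E) := by
  obtain ⟨s, hs⟩ := exists_isTranscendenceBasis F E
  have halg : Algebra.IsAlgebraic (IntermediateField.adjoin F s) E := by
    have := hs.isAlgebraic_field
    rwa [Subtype.range_coe] at this
  have : Algebra.EssFiniteType (IntermediateField.adjoin F s) E := .of_comp F _ _
  have : FiniteDimensional (IntermediateField.adjoin F s) E :=
    Algebra.finite_of_essFiniteType_of_isAlgebraic
  let b := Module.Basis.ofVectorSpace F (algebraicClosure F E)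
  have hb := hs.1.linearIndependent_adjoin b.linearIndependent
  rw [Subtype.range_coe] at hb
  open scoped IntermediateField.algebraAdjoinAdjoin in
  rw [LinearIndependent.iff_fractionRing _ (IntermediateField.adjoin F s)] at hb
  have := hb.finite
  exact .of_basis b

theorem essFiniteType_of_subfieldClosure_eq_top {F K : Type*} [Field F] [Field K] [Algebra F K]
    {S : Finset K} (hS : Subfield.closure (S : Set K) = ⊤) : Algebra.EssFiniteType F K := by
  rw [← IntermediateField.fg_top_iff]
  refine ⟨S, top_le_iff.mp fun x _ ↦ ?_⟩
  have hle : Subfield.closure (S : Set K) ≤ (IntermediateField.adjoin F (S : Set K)).toSubfield :=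
    Subfield.closure_le.mpr (IntermediateField.subset_adjoin F _)
  exact hle (hS ▸ Subfield.mem_top x)

theorem exists_forall_pow_three_ne {K : Type*} [Field K] [CharZero K]
    [FiniteDimensional ℚ (algebraicClosure ℚ K)] : ∃ a : K, ∀ b : K, b ^ 3 ≠ a := by
  by_contra! h
  have hroot : ∀ n : ℕ, ∃ b : K, b ^ 3 ^ n = 2 := by
    intro n
    induction n with
    | zero => exact ⟨2, by simp⟩
    | succ n ih =>
      obtain ⟨b, hb⟩ := ih
      obtain ⟨c, rfl⟩ := h b
      exact ⟨c, by rw [← hb, pow_succ', pow_mul]⟩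
  set n := Module.finrank ℚ (algebraicClosure ℚ K)
  obtain ⟨b, hb⟩ := hroot n
  have hirr : Irreducible (Polynomial.X ^ 3 ^ n - Polynomial.C 2 : Polynomial ℚ) := by
    refine X_pow_sub_C_irreducible_of_prime_pow Nat.prime_three (by norm_num) n fun q hq ↦ ?_
    have hval := congrArg (padicValRat 2) hq
    have hq0 : q ≠ 0 := by rintro rfl; norm_num at hq
    rw [padicValRat.pow, show (2 : ℚ) = ((2 : ℕ) : ℚ) by norm_num, padicValRat.self one_lt_two]
      at hval
    lia
  have hmonic : (Polynomial.X ^ 3 ^ n - Polynomial.C 2 : Polynomial ℚ).Monic :=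
    Polynomial.monic_X_pow_sub_C _ (by positivity)
  have hev : Polynomial.aeval b (Polynomial.X ^ 3 ^ n - Polynomial.C 2 : Polynomial ℚ) = 0 := by
    simp [hb]
  have hmem : b ∈ algebraicClosure ℚ K :=
    mem_algebraicClosure_iff.mpr ⟨_, hmonic.ne_zero, hev⟩
  have hev' : Polynomial.aeval (⟨b, hmem⟩ : algebraicClosure ℚ K)
      (Polynomial.X ^ 3 ^ n - Polynomial.C 2 : Polynomial ℚ) = 0 := by
    rw [← (algebraMap _ K).injective.eq_iff, map_zero,
      ← Polynomial.aeval_algebraMap_apply]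
    exact hev
  have hmin : minpoly ℚ (⟨b, hmem⟩ : algebraicClosure ℚ K) =
      Polynomial.X ^ 3 ^ n - Polynomial.C 2 :=
    (minpoly.eq_of_irreducible_of_monic hirr hev' hmonic).symm
  have hle := minpoly.natDegree_le (A := ℚ) (⟨b, hmem⟩ : algebraicClosure ℚ K)
  rw [hmin, Polynomial.natDegree_X_pow_sub_C] at hle
  exact absurd hle (not_le.mpr (Nat.lt_pow_self (by norm_num)))

universe u in
theorem exists_separable_cubic_extension_of_charZero {K : Type u} [Field K] [CharZero K]
    [FiniteDimensional ℚ (algebraicClosure ℚ K)] :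
    ∃ (L : Type u) (_ : Field L) (_ : Algebra K L),
      Module.finrank K L = 3 ∧ Algebra.IsSeparable K L := by
  obtain ⟨a, ha⟩ := exists_forall_pow_three_ne (K := K)
  have hirr := X_pow_sub_C_irreducible_of_prime Nat.prime_three ha
  have := Fact.mk hirr
  have hfin : FiniteDimensional K (AdjoinRoot (Polynomial.X ^ 3 - Polynomial.C a : Polynomial K)) :=
    (Polynomial.monic_X_pow_sub_C a three_ne_zero).finite_adjoinRoot
  refine ⟨AdjoinRoot (Polynomial.X ^ 3 - Polynomial.C a : Polynomial K),
    inferInstance, inferInstance, ?_, inferInstance⟩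
  rw [(AdjoinRoot.powerBasis hirr.ne_zero).finrank, AdjoinRoot.powerBasis_dim,
    Polynomial.natDegree_X_pow_sub_C]

universe u in
theorem exists_galois_cubic_extension_of_finite_algebraicClosure {F : Type*} {K : Type u}
    [Field F] [Field K] [Algebra F K] [Finite (algebraicClosure F K)] :
    ∃ (L : Type u) (_ : Field L) (_ : Algebra K L), Module.finrank K L = 3 ∧ IsGalois K L := by
  let A := algebraicClosure F K
  obtain ⟨p, hp⟩ := CharP.exists A
  have : Fact p.Prime := ⟨CharP.char_is_prime A p⟩
  let M := FiniteField.Extension A p 3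
  have hM : Module.finrank A M = 3 := FiniteField.finrank_extension A p 3
  obtain ⟨x, hx⟩ := Field.exists_primitive_element A M
  have hint : IsIntegral A x := Algebra.IsIntegral.isIntegral x
  set f := minpoly A x
  have hdeg : f.natDegree = 3 := by
    rw [← hM]
    exact (Field.primitive_element_iff_minpoly_natDegree_eq A x).mp hx
  have hf : Irreducible f := minpoly.irreducible hint
  have hsep : f.Separable := Algebra.IsSeparable.isSeparable A x
  have hdeg' : (f.map (algebraMap A K)).natDegree = 3 := by rw [Polynomial.natDegree_map, hdeg]
  have hirr : Irreducible (f.map (algebraMap A K)) := by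
    refine Polynomial.irreducible_of_degree_le_three_of_not_isRoot (by rw [hdeg']; decide)
      fun y hy ↦ ?_
    have hyf : Polynomial.aeval y f = 0 := by
      rwa [Polynomial.IsRoot, Polynomial.eval_map_algebraMap] at hy
    have hyF : y ∈ algebraicClosure F K :=
      mem_algebraicClosure_iff.mpr (IsAlgebraic.restrictScalars F ⟨f, hf.ne_zero, hyf⟩)
    have hroot : f.IsRoot (⟨y, hyF⟩ : A) := by
      have : algebraMap A K (f.eval ⟨y, hyF⟩) = 0 := by
        rw [← Polynomial.aeval_algebraMap_apply_eq_algebraMap_eval]; exact hyf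
      exact (map_eq_zero _).mp this
    have := Polynomial.natDegree_eq_of_degree_eq_some
      (Polynomial.degree_eq_one_of_irreducible_of_root hf hroot)
    exact absurd (hdeg.symm.trans this) (by decide)
  have := Fact.mk hirr
  let L := AdjoinRoot (f.map (algebraMap A K))
  let ρ : L := AdjoinRoot.root (f.map (algebraMap A K))
  have hρ : Polynomial.aeval ρ f = 0 := by
    rw [← Polynomial.aeval_map_algebraMap K, AdjoinRoot.aeval_eq, AdjoinRoot.mk_self]
  have hmin : minpoly A ρ = f :=
    (minpoly.eq_of_irreducible_of_monic hf hρ (minpoly.monic hint)).symm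
  have hsplitL : ((f.map (algebraMap A K)).map (algebraMap K L)).Splits := by
    rw [Polynomial.map_map, ← IsScalarTower.algebraMap_eq]
    have : FiniteDimensional A (IntermediateField.adjoin A {ρ}) :=
      IntermediateField.adjoin.finiteDimensional ⟨f, minpoly.monic hint, hρ⟩
    have : Finite (IntermediateField.adjoin A {ρ}) := Module.finite_of_finite A
    have hs := Normal.splits (F := A) inferInstance (IntermediateField.AdjoinSimple.gen A ρ)
    rw [IntermediateField.minpoly_gen, hmin] at hs
    have := hs.map (algebraMap (IntermediateField.adjoin A {ρ}) L)
    rwa [Polynomial.map_map, ← IsScalarTower.algebraMap_eq] at this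
  have : Polynomial.IsSplittingField K L (f.map (algebraMap A K)) := by
    refine ⟨hsplitL, top_le_iff.mp ?_⟩
    rw [← AdjoinRoot.adjoinRoot_eq_top]
    refine Algebra.adjoin_mono (Set.singleton_subset_iff.mpr ?_)
    rw [Polynomial.mem_rootSet_of_ne hirr.ne_zero, Polynomial.aeval_map_algebraMap]
    exact hρ
  refine ⟨L, inferInstance, inferInstance, ?_,
    .of_separable_splitting_field (hsep.map (f := algebraMap A K))⟩
  rw [(AdjoinRoot.powerBasis hirr.ne_zero).finrank, AdjoinRoot.powerBasis_dim, hdeg']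

section Embeddings

variable {K L M ι : Type*} [Field K] [Field L] [Algebra K L] [FiniteDimensional K L]
  [Algebra.IsSeparable K L] [Field M] [IsAlgClosed M] [Algebra K M] [Fintype ι]

theorem exists_equiv_det_embeddingsMatrixReindex_ne_zero [DecidableEq ι]
    (b : Module.Basis ι K L) :
    ∃ e : ι ≃ (L →ₐ[K] M), (Algebra.embeddingsMatrixReindex K M b e).det ≠ 0 := by
  obtain ⟨e⟩ : Nonempty (ι ≃ (L →ₐ[K] M)) := by
    rw [← Fintype.card_eq, AlgHom.card, Module.finrank_eq_card_basis b]
  refine ⟨e, fun h ↦ Algebra.discr_not_zero_of_basis K b ?_⟩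
  apply (algebraMap K M).injective
  rw [Algebra.discr_eq_det_embeddingsMatrixReindex_pow_two K M b e, h, map_zero]
  simp

theorem eq_zero_of_forall_sum_mul_embedding_basis_eq_zero (b : Module.Basis ι K L)
    {u : (L →ₐ[K] M) → M} (hu : ∀ i, ∑ φ, u φ * φ (b i) = 0) : u = 0 := by
  classical
  obtain ⟨e, he⟩ := exists_equiv_det_embeddingsMatrixReindex_ne_zero (M := M) b
  have := Matrix.eq_zero_of_mulVec_eq_zero he (v := u ∘ e) <| by
    ext i
    rw [Pi.zero_apply, ← hu i, ← e.sum_comp]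
    simp [Matrix.mulVec, dotProduct, Algebra.embeddingsMatrixReindex, Algebra.embeddingsMatrix,
      mul_comm]
  ext φ
  simpa using congrFun this (e.symm φ)

theorem eq_zero_of_forall_sum_embedding_basis_mul_eq_zero (b : Module.Basis ι K L)
    {t : ι → M} (ht : ∀ φ : L →ₐ[K] M, ∑ i, φ (b i) * t i = 0) : t = 0 := by
  classical
  obtain ⟨e, he⟩ := exists_equiv_det_embeddingsMatrixReindex_ne_zero (M := M) b
  refine Matrix.eq_zero_of_vecMul_eq_zero he ?_
  ext i
  rw [Pi.zero_apply, ← ht (e i)]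
  simp [Matrix.vecMul, dotProduct, Algebra.embeddingsMatrixReindex, Algebra.embeddingsMatrix,
    mul_comm]

end Embeddings

namespace MvPolynomial

section Trace

variable {σ K L M : Type*} [Field K] [Field L] [Algebra K L]

/-- The trace of a polynomial over `L`, taken coefficientwise. -/
noncomputable def coeffTrace (P : MvPolynomial σ L) : MvPolynomial σ K :=
  ∑ m ∈ P.support, monomial m (Algebra.trace K L (coeff m P))

theorem coeff_coeffTrace (P : MvPolynomial σ L) (m : σ →₀ ℕ) :
    coeff m (coeffTrace (K := K) P) = Algebra.trace K L (coeff m P) := by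
  classical
  simp only [coeffTrace, coeff_sum, coeff_monomial, Finset.sum_ite_eq', mem_support_iff]
  split_ifs with h
  · rfl
  · rw [not_not.mp h, map_zero]

theorem coeffTrace_add (P Q : MvPolynomial σ L) :
    coeffTrace (K := K) (P + Q) = coeffTrace P + coeffTrace Q := by
  ext m
  simp [coeff_coeffTrace]

theorem coeffTrace_C_algebraMap_mul (a : K) (P : MvPolynomial σ L) :
    coeffTrace (K := K) (C (algebraMap K L a) * P) = a • coeffTrace P := by
  ext m
  rw [coeff_smul, coeff_coeffTrace, coeff_coeffTrace, coeff_C_mul, ← Algebra.smul_def, map_smul]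

theorem IsHomogeneous.coeffTrace {P : MvPolynomial σ L} {d : ℕ} (hP : P.IsHomogeneous d) :
    (coeffTrace (K := K) P).IsHomogeneous d := by
  intro m hm
  refine hP fun h ↦ hm ?_
  rw [coeff_coeffTrace, h, map_zero]

variable [FiniteDimensional K L] [Algebra.IsSeparable K L] [Field M] [IsAlgClosed M] [Algebra K M]

theorem map_coeffTrace (P : MvPolynomial σ L) :
    map (algebraMap K M) (coeffTrace P) = ∑ φ : L →ₐ[K] M, map (φ : L →+* M) P := by
  ext m
  simp [coeff_sum, coeff_map, coeff_coeffTrace, trace_eq_sum_embeddings M]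

theorem eval_map_coeffTrace (t : σ → M) (P : MvPolynomial σ L) :
    eval t (map (algebraMap K M) (coeffTrace P)) = ∑ φ : L →ₐ[K] M, eval₂ (φ : L →+* M) t P := by
  simp [map_coeffTrace, map_sum, eval_map]

theorem eval_map_pderiv_coeffTrace (t : σ → M) (i : σ) (P : MvPolynomial σ L) :
    eval t (map (algebraMap K M) (pderiv i (coeffTrace P))) =
      ∑ φ : L →ₐ[K] M, eval₂ (φ : L →+* M) t (pderiv i P) := by
  rw [← pderiv_map, map_coeffTrace, map_sum, map_sum]
  exact Finset.sum_congr rfl fun φ _ ↦ by rw [pderiv_map, eval_map]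

end Trace

section LinearForm

variable {σ L M : Type*} [Field L] [Field M] [Fintype σ]

/-- The linear form with prescribed coefficients. -/
noncomputable def linearForm (c : σ → L) : MvPolynomial σ L := ∑ i, C (c i) * X i

theorem isHomogeneous_linearForm (c : σ → L) : (linearForm c).IsHomogeneous 1 :=
  IsHomogeneous.sum _ _ _ fun i _ ↦ by
    simpa using (isHomogeneous_C σ (c i)).mul (isHomogeneous_X L i)

theorem pderiv_linearForm (c : σ → L) (i : σ) : pderiv i (linearForm c) = C (c i) := by
  classical
  simp [linearForm, map_sum, pderiv_X, Pi.single_apply]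

theorem eval₂_linearForm (f : L →+* M) (t : σ → M) (c : σ → L) :
    eval₂ f t (linearForm c) = ∑ i, f (c i) * t i := by
  simp [linearForm, eval₂_sum]

end LinearForm

end MvPolynomial

section SmoothPencils

variable {K L : Type*} [Field K] [Field L] [Algebra K L] [FiniteDimensional K L]
  [Algebra.IsSeparable K L]

theorem cutsOutSmoothPlaneCurve_coeffTrace_linearForm_pow (b : Module.Basis (Fin 3) K L)
    {d : ℕ} (hd : 2 ≤ d) (hdK : (d : K) ≠ 0) {c : L} (hc : c ≠ 0) :
    CutsOutSmoothPlaneCurve (coeffTrace (K := K) (C c * linearForm b ^ d)) := by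
  rintro t ht ⟨-, hderiv⟩
  refine ht (eq_zero_of_forall_sum_embedding_basis_mul_eq_zero b ?_)
  have hu := eq_zero_of_forall_sum_mul_embedding_basis_eq_zero b
    (u := fun φ : L →ₐ[K] AlgebraicClosure K ↦
      φ c * (algebraMap K (AlgebraicClosure K) d * (∑ i, φ (b i) * t i) ^ (d - 1))) <| by
    intro i
    rw [← hderiv i, eval_map_pderiv_coeffTrace]
    refine Finset.sum_congr rfl fun φ _ ↦ ?_
    simp [pderiv_linearForm, eval₂_linearForm, eval₂_mul, eval₂_pow]
    ring
  intro φ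
  have hφ := congrFun hu φ
  have hφc : φ c ≠ 0 := (map_ne_zero φ).mpr hc
  have hd' : algebraMap K (AlgebraicClosure K) d ≠ 0 := (map_ne_zero _).mpr hdK
  simpa [hφc, hdK, -map_natCast, show d - 1 ≠ 0 by omega] using hφ

theorem cutsOutSmoothPlaneCurve_coeffTrace_linearForm_pow_mul (b : Module.Basis (Fin 3) K L)
    {d : ℕ} (hd : 2 ≤ d) (hdK : (d : K) = 0) (h3 : (3 : K) ≠ 0) (τ : L ≃ₐ[K] L)
    (hτ : ∀ φ ψ : L →ₐ[K] AlgebraicClosure K,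
      ψ = φ ∨ ψ = φ.comp τ ∨ ψ = (φ.comp τ).comp (τ : L →ₐ[K] L))
    (hτ3 : τ ^ 3 = 1) {c : L} (hc : c ≠ 0) :
    CutsOutSmoothPlaneCurve
      (coeffTrace (K := K) (C c * (linearForm b ^ (d - 1) * linearForm (τ ∘ b)))) := by
  rintro t ht ⟨hF, hderiv⟩
  obtain ⟨e, rfl⟩ : ∃ e, d = e + 2 := ⟨d - 2, by omega⟩
  have he : (((e + 1 : ℕ) : AlgebraicClosure K)) = -1 := by
    have : ((e + 2 : ℕ) : AlgebraicClosure K) = 0 := by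
      rw [← map_natCast (algebraMap K (AlgebraicClosure K)), hdK, map_zero]
    push_cast at this ⊢
    linear_combination this
  set y : (L →ₐ[K] AlgebraicClosure K) → AlgebraicClosure K :=
    fun φ ↦ ∑ i, φ (b i) * t i with hy
  refine ht (eq_zero_of_forall_sum_embedding_basis_mul_eq_zero b ?_)
  let s : (L →ₐ[K] AlgebraicClosure K) ≃ (L →ₐ[K] AlgebraicClosure K) :=
    τ.symm.arrowCongr AlgEquiv.refl
  have hs : ∀ φ, s φ = φ.comp τ := fun φ ↦ by ext; simp [s]
  have hs3 : ∀ φ, s (s (s φ)) = φ := fun φ ↦ by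
    ext x
    simpa [hs, pow_succ] using congrArg φ (DFunLike.congr_fun hτ3 x)
  simp only [← hs] at hτ
  have hu : ∀ φ, φ c * (y φ ^ (e + 1)) = s φ c * (y (s φ) ^ e * y (s (s φ))) := by
    have hsum := eq_zero_of_forall_sum_mul_embedding_basis_eq_zero b
      (u := fun φ ↦ s.symm φ c * y (s.symm φ) ^ (e + 1) - φ c * (y φ ^ e * y (s φ))) <| by
      intro i
      have hi := hderiv i
      rw [eval_map_pderiv_coeffTrace] at hi
      simp only [sub_mul, Finset.sum_sub_distrib]
      rw [← s.sum_comp (fun φ ↦ s.symm φ c * y (s.symm φ) ^ (e + 1) * φ (b i)),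
        ← Finset.sum_sub_distrib, ← hi]
      refine Finset.sum_congr rfl fun φ _ ↦ ?_
      simp only [Equiv.symm_apply_apply]
      simp [pderiv_linearForm, eval₂_linearForm, eval₂_mul, eval₂_pow, hy, hs]
      push_cast at he
      linear_combination (-1) * φ c * (∑ i, φ (b i) * t i) ^ e * φ (b i) *
        (∑ i, φ (τ (b i)) * t i) * he
    intro φ
    have := congrFun hsum (s φ)
    simpa [sub_eq_zero] using this
  have hterm : ∀ φ, s φ c * (y (s φ) ^ (e + 1) * y (s (s φ))) = φ c * (y φ ^ (e + 1) * y (s φ)) :=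
    fun φ ↦ by linear_combination -y (s φ) * hu φ
  have hconst : ∀ φ ψ, ψ c * (y ψ ^ (e + 1) * y (s ψ)) = φ c * (y φ ^ (e + 1) * y (s φ)) := by
    intro φ ψ
    rcases hτ φ ψ with rfl | rfl | rfl
    · rfl
    · exact hterm φ
    · rw [hterm, hterm]
  have hsum : ∑ φ, φ c * (y φ ^ (e + 1) * y (s φ)) = 0 := by
    rw [← hF, eval_map_coeffTrace]
    refine Finset.sum_congr rfl fun φ _ ↦ ?_
    simp [eval₂_linearForm, eval₂_mul, eval₂_pow, hy, hs]
  have hzero : ∀ φ, y φ = 0 ∨ y (s φ) = 0 := by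
    intro φ
    rw [Finset.sum_congr rfl fun ψ _ ↦ hconst φ ψ, Finset.sum_const, Finset.card_univ,
      AlgHom.card, Module.finrank_eq_card_basis b] at hsum
    have h3' : (3 : AlgebraicClosure K) ≠ 0 := by
      rw [← map_ofNat (algebraMap K (AlgebraicClosure K))]
      exact (map_ne_zero _).mpr h3
    simpa [h3', (map_ne_zero φ).mpr hc] using hsum
  intro φ
  change y φ = 0
  by_contra hφ
  have h2 : y (s (s φ)) = 0 := by
    have := hzero (s (s φ))
    rw [hs3] at this
    exact this.resolve_right hφ
  have := hu φ
  rw [h2] at this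
  simp [hφ, (map_ne_zero φ).mpr hc] at this

end SmoothPencils

theorem exists_pencil_of_forall_cutsOutSmoothPlaneCurve {K L : Type*} [Field K] [Field L]
    [Algebra K L] (h3 : Module.finrank K L = 3) {d : ℕ}
    {P : MvPolynomial (Fin 3) L} (hP : P.IsHomogeneous d)
    (hsmooth : ∀ c : L, c ≠ 0 → CutsOutSmoothPlaneCurve (coeffTrace (K := K) (C c * P))) :
    ∃ F₀ F₁ : MvPolynomial (Fin 3) K,
      LinearIndependent K ![F₀, F₁] ∧ F₀.IsHomogeneous d ∧ F₁.IsHomogeneous d ∧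
      ∀ a₀ a₁ : K, ¬ (a₀ = 0 ∧ a₁ = 0) → CutsOutSmoothPlaneCurve (a₀ • F₀ + a₁ • F₁) := by
  obtain ⟨α, hα⟩ : ∃ α : L, ∀ a : K, algebraMap K L a ≠ α := by
    by_contra! h
    have : Module.finrank K L = 1 := finrank_eq_one (1 : L) one_ne_zero fun x ↦ by
      obtain ⟨a, rfl⟩ := h x
      exact ⟨a, by rw [Algebra.smul_def, mul_one]⟩
    omega
  have hhom : ∀ c : L, (coeffTrace (K := K) (C c * P)).IsHomogeneous d := fun c ↦ by
    simpa using ((isHomogeneous_C _ c).mul hP).coeffTrace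
  have hpencil : ∀ a₀ a₁ : K, ¬ (a₀ = 0 ∧ a₁ = 0) →
      CutsOutSmoothPlaneCurve
        (a₀ • coeffTrace (K := K) (C 1 * P) + a₁ • coeffTrace (K := K) (C α * P)) := by
    intro a₀ a₁ ha
    have hc : algebraMap K L a₀ + algebraMap K L a₁ * α ≠ 0 := by
      intro h
      rcases eq_or_ne a₁ 0 with rfl | ha₁
      · exact ha ⟨by simpa using h, rfl⟩
      · refine hα (-a₀ / a₁) ?_
        have : algebraMap K L a₁ ≠ 0 := (map_ne_zero _).mpr ha₁
        rw [map_div₀, map_neg, div_eq_iff this]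
        linear_combination -h
    convert hsmooth _ hc using 1
    rw [C_add, add_mul, coeffTrace_add, coeffTrace_C_algebraMap_mul, C_mul, mul_assoc,
      coeffTrace_C_algebraMap_mul, C_1, one_mul]
  refine ⟨_, _, LinearIndependent.pair_iff.mpr fun a₀ a₁ h ↦ ?_, hhom 1, hhom α, hpencil⟩
  by_contra ha
  have := hpencil a₀ a₁ ha
  rw [h] at this
  exact this 1 one_ne_zero ⟨by simp, by simp⟩

theorem exists_algEquiv_of_isGalois_of_finrank_eq_three {K L M : Type*} [Field K] [Field L]
    [Algebra K L] [IsGalois K L] [Field M] [Algebra K M] (h3 : Module.finrank K L = 3) :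
    ∃ τ : L ≃ₐ[K] L, τ ^ 3 = 1 ∧
      ∀ φ ψ : L →ₐ[K] M, ψ = φ ∨ ψ = φ.comp τ ∨ ψ = (φ.comp τ).comp (τ : L →ₐ[K] L) := by
  have : FiniteDimensional K L := Module.finite_of_finrank_pos (by omega)
  have hcard : Nat.card (L ≃ₐ[K] L) = 3 := (IsGalois.card_aut_eq_finrank K L).trans h3
  have : Fact (Nat.Prime 3) := ⟨Nat.prime_three⟩
  have := isCyclic_of_prime_card hcard
  obtain ⟨τ, hτ⟩ := IsCyclic.exists_generator (α := L ≃ₐ[K] L)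
  have hτ3 : τ ^ 3 = 1 := hcard ▸ pow_card_eq_one'
  refine ⟨τ, hτ3, fun φ ψ ↦ ?_⟩
  obtain ⟨g, rfl⟩ : ∃ g : L ≃ₐ[K] L, ψ = φ.comp g := by
    let _ : Algebra L M := (φ : L →+* M).toAlgebra
    have : IsScalarTower K L M := .of_algebraMap_eq fun x ↦ (φ.commutes x).symm
    refine ⟨.ofBijective (ψ.restrictNormal L) (AlgHom.normal_bijective K L L _), ?_⟩
    ext x
    exact (ψ.restrictNormal_commutes L x).symm
  obtain ⟨n, hn, rfl⟩ : ∃ n < 3, τ ^ n = g := by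
    classical
    obtain ⟨n, hn, h⟩ := Finset.mem_image.mp (mem_zpowers_iff_mem_range_orderOf.mp (hτ g))
    refine ⟨n, ?_, h⟩
    rwa [Finset.mem_range, orderOf_eq_card_of_forall_mem_zpowers hτ, hcard] at hn
  interval_cases n
  · exact .inl (by ext; simp)
  · exact .inr (.inl (by ext; simp))
  · exact .inr (.inr (by ext; simp [pow_two]))

theorem exists_pencil_of_cubic_extension {K : Type*} (L : Type*) [Field K] [Field L] [Algebra K L]
    [Algebra.IsSeparable K L] (h3 : Module.finrank K L = 3) (hchar : ringChar K ≠ 3) {d : ℕ}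
    (hd : 2 ≤ d) (hdL : (d : K) ≠ 0 ∨ IsGalois K L) :
    ∃ F₀ F₁ : MvPolynomial (Fin 3) K,
      LinearIndependent K ![F₀, F₁] ∧ F₀.IsHomogeneous d ∧ F₁.IsHomogeneous d ∧
      ∀ a₀ a₁ : K, ¬ (a₀ = 0 ∧ a₁ = 0) → CutsOutSmoothPlaneCurve (a₀ • F₀ + a₁ • F₁) := by
  have : FiniteDimensional K L := Module.finite_of_finrank_pos (by omega)
  let b : Module.Basis (Fin 3) K L := Module.finBasisOfFinrankEq K L h3
  by_cases hdK : (d : K) = 0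
  · have : IsGalois K L := hdL.resolve_left (not_not.mpr hdK)
    obtain ⟨τ, hτ3, hτ⟩ :=
      exists_algEquiv_of_isGalois_of_finrank_eq_three (M := AlgebraicClosure K) h3
    refine exists_pencil_of_forall_cutsOutSmoothPlaneCurve h3
      (P := linearForm b ^ (d - 1) * linearForm (τ ∘ b)) ?_ fun c hc ↦
        cutsOutSmoothPlaneCurve_coeffTrace_linearForm_pow_mul b hd hdK ?_ τ hτ hτ3 hc
    · have := ((isHomogeneous_linearForm b).pow (d - 1)).mul
        (isHomogeneous_linearForm (τ ∘ b))
      rwa [one_mul, Nat.sub_add_cancel (by omega)] at this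
    · intro h
      rcases (Nat.dvd_prime Nat.prime_three).mp (ringChar.dvd (R := K) (x := 3) h) with h1 | h1
      · exact CharP.ringChar_ne_one h1
      · exact hchar h1
  · exact exists_pencil_of_forall_cutsOutSmoothPlaneCurve h3 (P := linearForm b ^ d)
      (by simpa using (isHomogeneous_linearForm b).pow d) fun c hc ↦
        cutsOutSmoothPlaneCurve_coeffTrace_linearForm_pow b hd hdK hc

/-- Over a finitely generated field `K` of characteristic different
from `3`, for every `d ≥ 2` there exists a `K`-smooth pencil of degree-`d` plane curves
in `ℙ^2`. -/
theorem exists_K_smooth_pencil_of_plane_curves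
    {K : Type*} [Field K]
    (hfg : ∃ S : Finset K, Subfield.closure (S : Set K) = ⊤)
    (hchar : ringChar K ≠ 3) (d : ℕ) (hd : 2 ≤ d) :
    ∃ F₀ F₁ : MvPolynomial (Fin 3) K,
      LinearIndependent K ![F₀, F₁] ∧
      F₀.IsHomogeneous d ∧ F₁.IsHomogeneous d ∧
      ∀ a₀ a₁ : K, ¬ (a₀ = 0 ∧ a₁ = 0) →
        CutsOutSmoothPlaneCurve (a₀ • F₀ + a₁ • F₁) := by
  obtain ⟨S, hS⟩ := hfg
  obtain ⟨p, _⟩ := CharP.exists K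
  rcases CharP.char_is_prime_or_zero K p with hp | rfl
  · have : Fact p.Prime := ⟨hp⟩
    let _ : Algebra (ZMod p) K := ZMod.algebra K p
    have := essFiniteType_of_subfieldClosure_eq_top (F := ZMod p) hS
    have := finiteDimensional_algebraicClosure_of_essFiniteType (ZMod p) K
    have : Finite (algebraicClosure (ZMod p) K) := Module.finite_of_finite (ZMod p)
    obtain ⟨L, _, _, h3, _⟩ :=
      exists_galois_cubic_extension_of_finite_algebraicClosure (F := ZMod p) (K := K)
    exact exists_pencil_of_cubic_extension L h3 hchar hd (.inr inferInstance)
  · have : CharZero K := CharP.charP_to_charZero K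
    have := essFiniteType_of_subfieldClosure_eq_top (F := ℚ) hS
    have := finiteDimensional_algebraicClosure_of_essFiniteType ℚ K
    obtain ⟨L, _, _, h3, hsep⟩ := exists_separable_cubic_extension_of_charZero (K := K)
    exact exists_pencil_of_cubic_extension L h3 hchar hd (.inl (Nat.cast_ne_zero.mpr (by omega)))
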